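/- arXiv:2205.15192 — 2 statements merged into one kernel-verified Lean document; each statement's English description precedes it below -/
import Mathlib

section
/- If ℓ does not divide 2g, then for every t ∈ ℤ the set C_Torus(ℓ,t) is non-empty; that is, there exists a tuple (M₁,…,M_g) of invertible diagonal 2 × 2 matrices over ℤ/ℓℤ with equal determinants such that tr M₁ + ⋯ + tr M_g ≡ −t (mod ℓ). -/
open Matrix Polynomial

abbrev GL2 (ℓ : ℕ) := Matrix.GeneralLinearGroup (Fin 2) (ZMod ℓ)

/-- The matrix of entries of an element of `GL₂(ℤ/ℓℤ)`. -/
abbrev mat {ℓ : ℕ} (M : GL2 ℓ) : Matrix (Fin 2) (Fin 2) (ZMod ℓ) := (M : Matrix (Fin 2) (Fin 2) (ZMod ℓ))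

/-- Upper triangular. -/
def IsUpper {ℓ : ℕ} (M : GL2 ℓ) : Prop := mat M 1 0 = 0

/-- Upper triangular with both diagonal entries equal to 1. -/
def IsUnip {ℓ : ℕ} (M : GL2 ℓ) : Prop := mat M 1 0 = 0 ∧ mat M 0 0 = 1 ∧ mat M 1 1 = 1

/-- Diagonal. -/
def IsDiagMat {ℓ : ℕ} (M : GL2 ℓ) : Prop := mat M 1 0 = 0 ∧ mat M 0 1 = 0

/-- Membership in `G(ℓ)`: all determinants agree. -/
def MemG {ℓ g : ℕ} (M : Fin g → GL2 ℓ) : Prop := ∀ i j, (mat (M i)).det = (mat (M j)).det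

def MemB {ℓ g : ℕ} (M : Fin g → GL2 ℓ) : Prop := (∀ i, IsUpper (M i)) ∧ MemG M

def MemU {ℓ g : ℕ} (M : Fin g → GL2 ℓ) : Prop := ∀ i, IsUnip (M i)

def MemU' {ℓ g : ℕ} (M : Fin g → GL2 ℓ) : Prop :=
  ∃ (lam : (ZMod ℓ)ˣ) (N : Fin g → GL2 ℓ), MemU N ∧
    ∀ i, mat (M i) = (lam : ZMod ℓ) • mat (N i)

def MemT {ℓ g : ℕ} (M : Fin g → GL2 ℓ) : Prop := (∀ i, IsDiagMat (M i)) ∧ MemG M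

/-- Sum of traces of the components. -/
def traceSum {ℓ g : ℕ} (M : Fin g → GL2 ℓ) : ZMod ℓ := ∑ i, (mat (M i)).trace

/-- The characteristic polynomial of each component splits into linear factors over `ℤ/ℓℤ`. -/
def SplitCharpoly {ℓ g : ℕ} (M : Fin g → GL2 ℓ) : Prop :=
  ∀ i, ∃ a b : ZMod ℓ, (mat (M i)).charpoly = (X - C a) * (X - C b)

/-- Membership in `C(ℓ,t)`. -/
def MemC {ℓ g : ℕ} (t : ℤ) (M : Fin g → GL2 ℓ) : Prop :=
  MemG M ∧ SplitCharpoly M ∧ traceSum M = ((-t : ℤ) : ZMod ℓ)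

/-- In a field of characteristic different from 2, every element is a sum of two nonzero elements. -/
lemma exists_ne_zero_add_eq {K : Type*} [Field K] (h2 : (2 : K) ≠ 0) (s : K) :
    ∃ a b : K, a ≠ 0 ∧ b ≠ 0 ∧ a + b = s := by
  by_cases hs : s = 0
  · exact ⟨1, -1, one_ne_zero, neg_ne_zero.mpr one_ne_zero, by simp [hs]⟩
  · exact ⟨s / 2, s / 2, div_ne_zero hs h2, div_ne_zero hs h2, by field_simp; ring⟩

/-- If `ℓ ∤ 2g` then `C_Torus(ℓ,t)` is non-empty. -/
theorem CTorus_nonempty (ℓ g : ℕ) (hℓ : ℓ.Prime) (hg : 1 ≤ g)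
    (hdvd : ¬ (ℓ ∣ 2 * g)) (t : ℤ) :
    ∃ M : Fin g → GL2 ℓ, (∀ i, IsDiagMat (M i)) ∧ MemG M ∧
      traceSum M = ((-t : ℤ) : ZMod ℓ) := by
  have : Fact ℓ.Prime := ⟨hℓ⟩
  have h2g : (2 : ZMod ℓ) * g ≠ 0 := by
    rw [← ZMod.natCast_eq_zero_iff] at hdvd
    exact_mod_cast hdvd
  have hg0 : (g : ZMod ℓ) ≠ 0 := right_ne_zero_of_mul h2g
  obtain ⟨a, b, ha, hb, hab⟩ :=
    exists_ne_zero_add_eq (left_ne_zero_of_mul h2g) (((-t : ℤ) : ZMod ℓ) / g)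
  refine ⟨fun _ => Matrix.GeneralLinearGroup.mkOfDetNeZero !![a, 0; 0, b]
    (by simp [Matrix.det_fin_two, ha, hb]), fun _ => ⟨rfl, rfl⟩, fun _ _ => rfl, ?_⟩
  have htr : Matrix.trace !![a, 0; 0, b] = ((-t : ℤ) : ZMod ℓ) / g := by
    rw [Matrix.trace_fin_two, ← hab]; rfl
  change ∑ _i : Fin g, Matrix.trace !![a, 0; 0, b] = _
  rw [htr, Finset.sum_const, Finset.card_univ, Fintype.card_fin, nsmul_eq_mul,
    mul_div_cancel₀ _ hg0]
end

section
/- For every t ∈ ℤ, the set C_Torus(ℓ,t) has cardinality at most 2(ℓ − 1)^g. -/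
open Matrix Polynomial

theorem ncard_forall_ne_zero {F ι : Type*} [Field F] [Fintype F] [Fintype ι] :
    {f : ι → F | ∀ i, f i ≠ 0}.ncard = (Fintype.card F - 1) ^ Fintype.card ι := by
  classical
  have h : {f : ι → F | ∀ i, f i ≠ 0} =
      (Fintype.piFinset fun _ : ι => (Finset.univ.erase (0 : F)) : Finset (ι → F)) := by
    ext f
    simp
  rw [h, Set.ncard_coe_finset]
  simp [Finset.card_univ]

theorem IsDiagMat.det_eq {ℓ : ℕ} {M : GL2 ℓ} (h : IsDiagMat M) :
    (mat M).det = mat M 0 0 * mat M 1 1 := by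
  rw [Matrix.det_fin_two, h.1, h.2]
  ring

section Prime

variable {ℓ g : ℕ} [Fact ℓ.Prime]

theorem mat_det_ne_zero (M : GL2 ℓ) : (mat M).det ≠ 0 :=
  (Matrix.isUnits_det_units M).ne_zero

theorem IsDiagMat.apply_zero_ne_zero {M : GL2 ℓ} (h : IsDiagMat M) : mat M 0 0 ≠ 0 :=
  left_ne_zero_of_mul (h.det_eq ▸ mat_det_ne_zero M)

theorem IsDiagMat.apply_one_eq {M : GL2 ℓ} (h : IsDiagMat M) :
    mat M 1 1 = (mat M).det * (mat M 0 0)⁻¹ := by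
  rw [eq_mul_inv_iff_mul_eq₀ h.apply_zero_ne_zero, h.det_eq, mul_comm]

theorem MemT.ext {M N : Fin g → GL2 ℓ} (hM : MemT M) (hN : MemT N) (i₀ : Fin g)
    (ha : ∀ i, mat (M i) 0 0 = mat (N i) 0 0) (hd : (mat (M i₀)).det = (mat (N i₀)).det) :
    M = N := by
  funext i
  have h11 : mat (M i) 1 1 = mat (N i) 1 1 := by
    rw [(hM.1 i).apply_one_eq, (hN.1 i).apply_one_eq, ha, hM.2 i i₀, hN.2 i i₀, hd]
  apply Units.ext
  ext j k
  fin_cases j <;> fin_cases k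
  · exact ha i
  · exact (hM.1 i).2.trans (hN.1 i).2.symm
  · exact (hM.1 i).1.trans (hN.1 i).1.symm
  · exact h11

theorem MemT.traceSum_eq {M : Fin g → GL2 ℓ} (hM : MemT M) (i₀ : Fin g) :
    traceSum M = ∑ i, mat (M i) 0 0 + (mat (M i₀)).det * ∑ i, (mat (M i) 0 0)⁻¹ := by
  rw [traceSum, Finset.mul_sum, ← Finset.sum_add_distrib]
  refine Finset.sum_congr rfl fun i _ => ?_
  rw [Matrix.trace_fin_two, (hM.1 i).apply_one_eq, hM.2 i i₀]

/-- A torus element of given trace whose upper left entries have nonzero inverse sum is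
determined by these entries. -/
theorem ncard_sum_inv_ne_zero_le (i₀ : Fin g) (s : ZMod ℓ) :
    {M : Fin g → GL2 ℓ | MemT M ∧ traceSum M = s ∧ ∑ i, (mat (M i) 0 0)⁻¹ ≠ 0}.ncard ≤
      (ℓ - 1) ^ g := by
  have hcard := ncard_forall_ne_zero (F := ZMod ℓ) (ι := Fin g)
  rw [ZMod.card, Fintype.card_fin] at hcard
  rw [← hcard]
  refine Set.ncard_le_ncard_of_injOn (fun M i => mat (M i) 0 0)
    (fun M hM i => (hM.1.1 i).apply_zero_ne_zero) ?_ (Set.toFinite _)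
  rintro M ⟨hM, hMs, hM0⟩ N ⟨hN, hNs, -⟩ h
  have ha : ∀ i, mat (M i) 0 0 = mat (N i) 0 0 := congrFun h
  refine hM.ext hN i₀ ha (mul_right_cancel₀ hM0 ?_)
  have hs := hMs.trans hNs.symm
  rw [hM.traceSum_eq i₀, hN.traceSum_eq i₀] at hs
  simp only [ha] at hs ⊢
  exact add_left_cancel hs

/-- A torus element whose upper left entries have zero inverse sum is determined by its
common determinant and all but one of these entries. -/
theorem ncard_sum_inv_eq_zero_le (i₀ : Fin g) :
    {M : Fin g → GL2 ℓ | MemT M ∧ ∑ i, (mat (M i) 0 0)⁻¹ = 0}.ncard ≤ (ℓ - 1) ^ g := by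
  have hcard := ncard_forall_ne_zero (F := ZMod ℓ) (ι := Fin g)
  rw [ZMod.card, Fintype.card_fin] at hcard
  rw [← hcard]
  refine Set.ncard_le_ncard_of_injOn
    (fun M => Function.update (fun i => mat (M i) 0 0) i₀ (mat (M i₀)).det)
    (fun M hM i => ?_) ?_ (Set.toFinite _)
  · rcases eq_or_ne i i₀ with rfl | hi
    · simpa only [Function.update_self] using mat_det_ne_zero (M i)
    · simpa only [Function.update_of_ne hi] using (hM.1.1 i).apply_zero_ne_zero
  · rintro M ⟨hM, hM0⟩ N ⟨hN, hN0⟩ h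
    have hd : (mat (M i₀)).det = (mat (N i₀)).det := by
      simpa only [Function.update_self] using congrFun h i₀
    have ha : ∀ i, i ≠ i₀ → mat (M i) 0 0 = mat (N i) 0 0 := fun i hi => by
      simpa only [Function.update_of_ne hi] using congrFun h i
    refine hM.ext hN i₀ (fun i => ?_) hd
    rcases eq_or_ne i i₀ with rfl | hi
    · have hs := hM0.trans hN0.symm
      rw [← Finset.add_sum_erase _ _ (Finset.mem_univ i),
        ← Finset.add_sum_erase _ _ (Finset.mem_univ i),
        Finset.sum_congr rfl fun j hj => by rw [ha j (Finset.ne_of_mem_erase hj)]] at hs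
      exact inv_injective (add_right_cancel hs)
    · exact ha i hi

end Prime

/-- `|C_Torus(ℓ,t)| ≤ 2 (ℓ-1)^g`. -/
theorem card_CTorus_le (ℓ g : ℕ) (hℓ : ℓ.Prime) (hg : 1 ≤ g) (t : ℤ) :
    {M : Fin g → GL2 ℓ | MemT M ∧ traceSum M = ((-t : ℤ) : ZMod ℓ)}.ncard ≤
      2 * (ℓ - 1) ^ g := by
  have : Fact ℓ.Prime := ⟨hℓ⟩
  let i₀ : Fin g := ⟨0, hg⟩
  calc _ ≤ ({M : Fin g → GL2 ℓ | MemT M ∧ traceSum M = ((-t : ℤ) : ZMod ℓ) ∧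
            ∑ i, (mat (M i) 0 0)⁻¹ ≠ 0} ∪
          {M : Fin g → GL2 ℓ | MemT M ∧ ∑ i, (mat (M i) 0 0)⁻¹ = 0}).ncard := by
        refine Set.ncard_le_ncard (fun M hM => ?_) (Set.toFinite _)
        by_cases h : ∑ i, (mat (M i) 0 0)⁻¹ = 0
        · exact Or.inr ⟨hM.1, h⟩
        · exact Or.inl ⟨hM.1, hM.2, h⟩
    _ ≤ (ℓ - 1) ^ g + (ℓ - 1) ^ g :=
        (Set.ncard_union_le _ _).trans
          (add_le_add (ncard_sum_inv_ne_zero_le i₀ _) (ncard_sum_inv_eq_zero_le i₀))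
    _ = 2 * (ℓ - 1) ^ g := (two_mul _).symm
end
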